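/- arXiv:1210.4681 — 4 statements merged into one kernel-verified Lean document; each statement's English description precedes it below -/
import Mathlib

section
/- Let V(r) ⊂ ℝ³ be the 8-point set consisting of A=(1,-1,-1), B=(-1,1,-1), C=(-1,-1,1), D=(1,1,1) together with (r/3)(-1,1,1), (r/3)(1,-1,1), (r/3)(1,1,-1), (r/3)(-1,-1,-1), for a parameter r>0. A continuous function f:ℝ³→ℝ satisfies f(x) = (1/8)·Σ_{v∈V(r)} f(x+s·v) for all x∈ℝ³ and all s>0 if and only if: (when r=3) f coincides with the function of a polynomial p∈ℝ[x₁,x₂,x₃] satisfying e₂(∂)p = e₄(∂)p = e₆(∂)p = 0; and (when r≠3) f coincides with the function of a polynomial p satisfying e₂(∂)p = e₃(∂)p = e₄(∂)p = 0. -/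
open MvPolynomial

noncomputable def dop (φ : MvPolynomial (Fin 3) ℝ) :
    MvPolynomial (Fin 3) ℝ →ₗ[ℝ] MvPolynomial (Fin 3) ℝ :=
  φ.support.sum fun s => φ.coeff s •
    (((pderiv (0 : Fin 3)).toLinearMap ^ s 0) *
     ((pderiv (1 : Fin 3)).toLinearMap ^ s 1) *
     ((pderiv (2 : Fin 3)).toLinearMap ^ s 2))

noncomputable def e2 : MvPolynomial (Fin 3) ℝ := X 0 ^ 2 + X 1 ^ 2 + X 2 ^ 2
noncomputable def e3 : MvPolynomial (Fin 3) ℝ := X 0 * X 1 * X 2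
noncomputable def e4 : MvPolynomial (Fin 3) ℝ :=
  X 1 ^ 2 * X 2 ^ 2 + X 2 ^ 2 * X 0 ^ 2 + X 0 ^ 2 * X 1 ^ 2
noncomputable def e6 : MvPolynomial (Fin 3) ℝ := X 0 ^ 2 * X 1 ^ 2 * X 2 ^ 2

/-- Vertices of the regular tetrahedron. -/
def vA : Fin 3 → ℝ := ![1, -1, -1]
def vB : Fin 3 → ℝ := ![-1, 1, -1]
def vC : Fin 3 → ℝ := ![-1, -1, 1]
def vD : Fin 3 → ℝ := ![1, 1, 1]

/-- Apex vertices of the isohedral triakis tetrahedron with parameter `r`. -/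
noncomputable def va (r : ℝ) : Fin 3 → ℝ := (r / 3) • ![-1, 1, 1]
noncomputable def vb (r : ℝ) : Fin 3 → ℝ := (r / 3) • ![1, -1, 1]
noncomputable def vc (r : ℝ) : Fin 3 → ℝ := (r / 3) • ![1, 1, -1]
noncomputable def vd (r : ℝ) : Fin 3 → ℝ := (r / 3) • ![-1, -1, -1]

open scoped ContDiff

section Operators

variable {M : Type*} [AddCommGroup M] [Module ℝ M]

/-- The ordered monomials in three commuting endomorphisms, as a monoid homomorphism from
exponents. -/
noncomputable def monomialHom (D : Fin 3 → Module.End ℝ M) (h : ∀ i j, Commute (D i) (D j)) :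
    Multiplicative (Fin 3 →₀ ℕ) →* Module.End ℝ M where
  toFun s := D 0 ^ s.toAdd 0 * D 1 ^ s.toAdd 1 * D 2 ^ s.toAdd 2
  map_one' := by simp
  map_mul' s t := by
    have h1 := ((h 1 0).pow_pow (s.toAdd 1) (t.toAdd 0)).eq
    have h2 := ((h 2 0).pow_pow (s.toAdd 2) (t.toAdd 0)).eq
    have h3 := ((h 2 1).pow_pow (s.toAdd 2) (t.toAdd 1)).eq
    simp only [toAdd_mul, Finsupp.add_apply, pow_add, mul_assoc]
    congr 1
    rw [← mul_assoc (D 2 ^ s.toAdd 2) (D 0 ^ t.toAdd 0), h2, mul_assoc,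
      ← mul_assoc (D 1 ^ s.toAdd 1) (D 0 ^ t.toAdd 0), h1, mul_assoc]
    congr 2
    rw [← mul_assoc (D 2 ^ s.toAdd 2), h3, mul_assoc]

/-- The algebra homomorphism from polynomials to endomorphisms which sends `X i` to `D i`, for a
family of three commuting endomorphisms. -/
noncomputable def opHom (D : Fin 3 → Module.End ℝ M) (h : ∀ i j, Commute (D i) (D j)) :
    MvPolynomial (Fin 3) ℝ →ₐ[ℝ] Module.End ℝ M :=
  AddMonoidAlgebra.lift ℝ (Module.End ℝ M) (Fin 3 →₀ ℕ) (monomialHom D h)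

theorem opHom_eq_sum (D : Fin 3 → Module.End ℝ M) (h : ∀ i j, Commute (D i) (D j))
    (φ : MvPolynomial (Fin 3) ℝ) :
    opHom D h φ = ∑ s ∈ φ.support, φ.coeff s • (D 0 ^ s 0 * D 1 ^ s 1 * D 2 ^ s 2) :=
  AddMonoidAlgebra.lift_apply _ _

theorem opHom_X (D : Fin 3 → Module.End ℝ M) (h : ∀ i j, Commute (D i) (D j)) (i : Fin 3) :
    opHom D h (X i) = D i := by
  refine (AddMonoidAlgebra.lift_single (monomialHom D h) (Finsupp.single i 1) 1).trans ?_
  fin_cases i <;> simp [monomialHom]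

/-- The polynomials whose associated operator annihilates `m`. -/
noncomputable def annIdeal (Φ : MvPolynomial (Fin 3) ℝ →ₐ[ℝ] Module.End ℝ M) (m : M) :
    Ideal (MvPolynomial (Fin 3) ℝ) where
  carrier := {φ | Φ φ m = 0}
  add_mem' {a b} ha hb := by
    simp only [Set.mem_ofPred_eq] at *
    simp [ha, hb]
  zero_mem' := by simp
  smul_mem' c φ hφ := by
    simp only [Set.mem_ofPred_eq] at *
    simp [hφ]

theorem mem_annIdeal {Φ : MvPolynomial (Fin 3) ℝ →ₐ[ℝ] Module.End ℝ M} {m : M}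
    {φ : MvPolynomial (Fin 3) ℝ} : φ ∈ annIdeal Φ m ↔ Φ φ m = 0 := Iff.rfl

end Operators

section SmoothFunctions

/-- The space of smooth functions on `ℝ³`. -/
def smoothFun : Submodule ℝ ((Fin 3 → ℝ) → ℝ) where
  carrier := {g | ContDiff ℝ ∞ g}
  add_mem' ha hb := by
    rw [Set.mem_ofPred_eq] at *
    exact ha.add hb
  zero_mem' := by
    rw [Set.mem_ofPred_eq]
    exact contDiff_const
  smul_mem' c g hg := by
    rw [Set.mem_ofPred_eq] at *
    exact contDiff_const.smul hg

theorem mem_smoothFun {g : (Fin 3 → ℝ) → ℝ} : g ∈ smoothFun ↔ ContDiff ℝ ∞ g := Iff.rfl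

theorem smoothFun.contDiff (g : smoothFun) : ContDiff ℝ ∞ g.1 := mem_smoothFun.1 g.2

/-- The directional derivative along `v` as an endomorphism of the space of smooth functions. -/
noncomputable def dirDeriv (v : Fin 3 → ℝ) : Module.End ℝ smoothFun where
  toFun g := ⟨fun x => fderiv ℝ g.1 x v, mem_smoothFun.2 <|
    ((smoothFun.contDiff g).fderiv_right (m := ∞) (by simp)).clm_apply contDiff_const⟩
  map_add' g h := by
    ext x
    have hg : DifferentiableAt ℝ g.1 x := ((smoothFun.contDiff g).differentiable (by simp)) x
    have hh : DifferentiableAt ℝ h.1 x := ((smoothFun.contDiff h).differentiable (by simp)) x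
    simp [fderiv_add hg hh]
  map_smul' c g := by
    ext x
    have hg : DifferentiableAt ℝ g.1 x := ((smoothFun.contDiff g).differentiable (by simp)) x
    simp [fderiv_const_smul hg]

theorem dirDeriv_apply (v : Fin 3 → ℝ) (g : smoothFun) (x : Fin 3 → ℝ) :
    (dirDeriv v g).1 x = fderiv ℝ g.1 x v := rfl

theorem dirDeriv_commute (v w : Fin 3 → ℝ) : Commute (dirDeriv v) (dirDeriv w) := by
  ext g x
  have hsym : IsSymmSndFDerivAt ℝ g.1 x :=
    ((smoothFun.contDiff g).contDiffAt).isSymmSndFDerivAt 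
      (by rw [minSmoothness_of_isRCLikeNormedField]; exact WithTop.coe_le_coe.2 le_top)
  have hd : DifferentiableAt ℝ (fderiv ℝ g.1) x :=
    (((smoothFun.contDiff g).fderiv_right (m := ∞) (by simp)).differentiable (by simp)) x
  have key : ∀ a b : Fin 3 → ℝ,
      (dirDeriv a (dirDeriv b g)).1 x = fderiv ℝ (fderiv ℝ g.1) x a b := by
    intro a b
    rw [dirDeriv_apply]
    have : (dirDeriv b g).1 = fun y => fderiv ℝ g.1 y b := rfl
    rw [this, fderiv_clm_apply hd (differentiableAt_const b)]
    simp
  exact (key v w).trans ((hsym v w).trans (key w v).symm)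

/-- The action of constant coefficient differential operators on smooth functions. -/
noncomputable def diffOp : MvPolynomial (Fin 3) ℝ →ₐ[ℝ] Module.End ℝ smoothFun :=
  opHom (fun i => dirDeriv (Pi.single i 1)) fun _ _ => dirDeriv_commute _ _

/-- The linear form with coefficient vector `v`. -/
noncomputable def linForm (v : Fin 3 → ℝ) : MvPolynomial (Fin 3) ℝ := ∑ i, C (v i) * X i

theorem diffOp_X (i : Fin 3) : diffOp (X i) = dirDeriv (Pi.single i 1) := opHom_X _ _ i

theorem diffOp_linForm (v : Fin 3 → ℝ) : diffOp (linForm v) = dirDeriv v := by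
  ext g x
  have hv : v = ∑ i, v i • (Pi.single i 1 : Fin 3 → ℝ) := by
    ext j; simp [Finset.sum_apply, Pi.single_apply]
  rw [dirDeriv_apply]
  conv_rhs => rw [hv]
  simp [linForm, ← algebraMap_eq, diffOp_X, dirDeriv_apply, Fin.sum_univ_three,
    Module.algebraMap_end_apply]

theorem hasDerivAt_line (g : smoothFun) (x v : Fin 3 → ℝ) (s : ℝ) :
    HasDerivAt (fun t : ℝ => g.1 (x + t • v)) ((diffOp (linForm v) g).1 (x + s • v)) s := by
  rw [diffOp_linForm, dirDeriv_apply]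
  have h1 : HasFDerivAt g.1 (fderiv ℝ g.1 (x + s • v)) (x + s • v) :=
    (((smoothFun.contDiff g).differentiable (by simp)) _).hasFDerivAt
  have h2 : HasDerivAt (fun t : ℝ => x + t • v) v s := by
    simpa using ((hasDerivAt_id s).smul_const v).const_add x
  exact h1.comp_hasDerivAt s h2

theorem hasDerivAt_update_apply (g : smoothFun) (x : Fin 3 → ℝ) (i : Fin 3) (s : ℝ) :
    HasDerivAt (fun t : ℝ => g.1 (Function.update x i t))
      ((diffOp (X i) g).1 (Function.update x i s)) s := by
  rw [diffOp_X, dirDeriv_apply]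
  exact (((smoothFun.contDiff g).differentiable (by simp)) _).hasFDerivAt.comp_hasDerivAt s (hasDerivAt_update x i s)

theorem contDiff_eval (p : MvPolynomial (Fin 3) ℝ) :
    ContDiff ℝ ∞ (fun x : Fin 3 → ℝ => eval x p) := by
  induction p using MvPolynomial.induction_on with
  | C a => simpa using contDiff_const
  | add p q hp hq => simpa using hp.add hq
  | mul_X p i hp => simpa using hp.mul (contDiff_apply ℝ ℝ i)

/-- Polynomials as smooth functions. -/
noncomputable def polyFun : MvPolynomial (Fin 3) ℝ →ₗ[ℝ] smoothFun where
  toFun p := ⟨fun x => eval x p, mem_smoothFun.2 (contDiff_eval p)⟩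
  map_add' p q := by ext x; simp
  map_smul' c p := by ext x; simp [smul_eval]

theorem polyFun_apply (p : MvPolynomial (Fin 3) ℝ) (x : Fin 3 → ℝ) :
    (polyFun p).1 x = eval x p := rfl

theorem polyFun_eq_zero {p : MvPolynomial (Fin 3) ℝ} : polyFun p = 0 ↔ p = 0 := by
  refine ⟨fun h => MvPolynomial.funext fun x => ?_, fun h => by simp [h]⟩
  have := congrArg (fun g : smoothFun => g.1 x) h
  simpa [polyFun_apply] using this

theorem dirDeriv_polyFun (i : Fin 3) (p : MvPolynomial (Fin 3) ℝ) :
    dirDeriv (Pi.single i 1) (polyFun p) = polyFun (pderiv i p) := by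
  ext x
  rw [dirDeriv_apply, polyFun_apply]
  have hfun : ∀ q, (polyFun q).1 = fun y => eval y q := fun _ => rfl
  have hdiff : ∀ q, DifferentiableAt ℝ (fun y : Fin 3 → ℝ => eval y q) x := fun q =>
    ((contDiff_eval q).differentiable (by simp)) x
  rw [hfun]
  induction p using MvPolynomial.induction_on with
  | C a => simp
  | add p q hp hq =>
    simp only [map_add]
    rw [fderiv_fun_add (hdiff p) (hdiff q), add_apply, hp, hq]
  | mul_X p j hp =>
    have hX : HasFDerivAt (fun y : Fin 3 → ℝ => y j) (ContinuousLinearMap.proj (R := ℝ) j) x :=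
      hasFDerivAt_apply j x
    simp only [map_mul, eval_X]
    rw [((hdiff p).hasFDerivAt.fun_mul hX).fderiv]
    simp [hp, Derivation.leibniz, pderiv_X, Pi.single_apply]
    split_ifs <;> simp_all

theorem diffOp_polyFun (φ p : MvPolynomial (Fin 3) ℝ) :
    diffOp φ (polyFun p) = polyFun (dop φ p) := by
  have hpow : ∀ (i : Fin 3) (n : ℕ) (q : MvPolynomial (Fin 3) ℝ),
      (dirDeriv (Pi.single i 1) ^ n) (polyFun q) =
        polyFun (((pderiv i).toLinearMap ^ n : Module.End ℝ (MvPolynomial (Fin 3) ℝ)) q) := by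
    intro i n
    induction n with
    | zero => simp
    | succ n ih =>
      intro q
      rw [pow_succ, pow_succ, Module.End.mul_apply, Module.End.mul_apply, dirDeriv_polyFun, ih]
      rfl
  rw [diffOp, opHom_eq_sum, dop]
  simp [LinearMap.sum_apply, map_sum, hpow]

end SmoothFunctions

section PowerSums

/-- The vertices of the triakis tetrahedron. -/
noncomputable def vert (r : ℝ) : Fin 8 → Fin 3 → ℝ :=
  ![vA, vB, vC, vD, va r, vb r, vc r, vd r]

/-- The power sum of the linear forms attached to the vertices of the triakis tetrahedron. -/
noncomputable def powSum (r : ℝ) (k : ℕ) : MvPolynomial (Fin 3) ℝ :=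
  ∑ i, linForm (vert r i) ^ k

/-- The power sum of the linear forms attached to the vertices of the regular tetrahedron. -/
noncomputable def tetraSum (k : ℕ) : MvPolynomial (Fin 3) ℝ :=
  linForm vA ^ k + linForm vB ^ k + linForm vC ^ k + linForm vD ^ k

theorem linForm_smul (c : ℝ) (v : Fin 3 → ℝ) : linForm (c • v) = C c * linForm v := by
  simp [linForm, Finset.mul_sum, mul_assoc]

theorem linForm_vA : linForm vA = X 0 - X 1 - X 2 := by
  simp [linForm, vA, Fin.sum_univ_three]; ring

theorem linForm_vB : linForm vB = -X 0 + X 1 - X 2 := by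
  simp [linForm, vB, Fin.sum_univ_three]; ring

theorem linForm_vC : linForm vC = -X 0 - X 1 + X 2 := by
  simp [linForm, vC, Fin.sum_univ_three]; ring

theorem linForm_vD : linForm vD = X 0 + X 1 + X 2 := by
  simp [linForm, vD, Fin.sum_univ_three]

theorem va_eq (r : ℝ) : va r = (-(r / 3)) • vA := by
  ext i; fin_cases i <;> simp [va, vA]

theorem vb_eq (r : ℝ) : vb r = (-(r / 3)) • vB := by
  ext i; fin_cases i <;> simp [vb, vB]

theorem vc_eq (r : ℝ) : vc r = (-(r / 3)) • vC := by
  ext i; fin_cases i <;> simp [vc, vC]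

theorem vd_eq (r : ℝ) : vd r = (-(r / 3)) • vD := by
  ext i; fin_cases i <;> simp [vd, vD]

theorem powSum_eq (r : ℝ) (k : ℕ) : powSum r k = C (1 + (-(r / 3)) ^ k) * tetraSum k := by
  simp only [powSum, vert, Fin.sum_univ_eight, Matrix.cons_val, va_eq, vb_eq, vc_eq, vd_eq,
    linForm_smul, mul_pow, tetraSum, map_add, map_one, map_pow]
  ring

theorem tetraSum_one : tetraSum 1 = 0 := by
  simp only [tetraSum, linForm_vA, linForm_vB, linForm_vC, linForm_vD]; ring

theorem tetraSum_two : tetraSum 2 = C 4 * e2 := by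
  simp only [tetraSum, linForm_vA, linForm_vB, linForm_vC, linForm_vD, e2, map_ofNat]; ring

theorem tetraSum_three : tetraSum 3 = C 24 * e3 := by
  simp only [tetraSum, linForm_vA, linForm_vB, linForm_vC, linForm_vD, e3, map_ofNat]; ring

theorem tetraSum_four : tetraSum 4 = 4 * e2 * e2 + C 16 * e4 := by
  simp only [tetraSum, linForm_vA, linForm_vB, linForm_vC, linForm_vD, e2, e4, map_ofNat]; ring

theorem tetraSum_six : tetraSum 6 = (4 * e2 ^ 2 + 48 * e4) * e2 + C 192 * e6 := by
  simp only [tetraSum, linForm_vA, linForm_vB, linForm_vC, linForm_vD, e2, e4, e6, map_ofNat]; ring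

theorem X_pow_six (i : Fin 3) : (X i : MvPolynomial (Fin 3) ℝ) ^ 6 =
    X i ^ 4 * e2 - X i ^ 2 * e4 + 1 * e6 := by
  obtain rfl | rfl | rfl : i = 0 ∨ i = 1 ∨ i = 2 := by fin_cases i <;> simp
  all_goals simp only [e2, e4, e6]; ring

/-- The linear forms of the vertices of the regular tetrahedron. -/
def IsTetraForm (y : MvPolynomial (Fin 3) ℝ) : Prop :=
  y = linForm vA ∨ y = linForm vB ∨ y = linForm vC ∨ y = linForm vD

theorem IsTetraForm.pow_four {y : MvPolynomial (Fin 3) ℝ} (hy : IsTetraForm y) :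
    y ^ 4 = (2 * y ^ 2 - e2) * e2 + 8 * y * e3 + 4 * e4 := by
  rcases hy with rfl | rfl | rfl | rfl <;>
    simp only [linForm_vA, linForm_vB, linForm_vC, linForm_vD, e2, e3, e4] <;> ring

theorem IsTetraForm.pow_eight {y : MvPolynomial (Fin 3) ℝ} (hy : IsTetraForm y) :
    y ^ 8 = (2 * y ^ 4 - (2 * y ^ 2 - e2) * e2 - 4 * e4) * ((2 * y ^ 2 - e2) * e2 + 4 * e4) +
      64 * y ^ 2 * e6 := by
  have h6 : e6 = e3 ^ 2 := by simp only [e3, e6]; ring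
  have h := hy.pow_four
  have h' : (y ^ 4 - ((2 * y ^ 2 - e2) * e2 + 4 * e4)) ^ 2 = 64 * y ^ 2 * e6 := by
    rw [h, h6]; ring
  linear_combination h'

variable {I : Ideal (MvPolynomial (Fin 3) ℝ)}

theorem C_mul_mem_iff {c : ℝ} (hc : c ≠ 0) {q : MvPolynomial (Fin 3) ℝ} :
    C c * q ∈ I ↔ q ∈ I :=
  I.unit_mul_mem_iff_mem ((isUnit_iff_ne_zero.2 hc).map C)

theorem tetraForm_pow_mem (h2 : e2 ∈ I) (h3 : e3 ∈ I) (h4 : e4 ∈ I)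
    {y : MvPolynomial (Fin 3) ℝ} (hy : IsTetraForm y) (k : ℕ) : y ^ (k + 4) ∈ I := by
  rw [pow_add, hy.pow_four]
  exact I.mul_mem_left _ (I.add_mem (I.add_mem (I.mul_mem_left _ h2) (I.mul_mem_left _ h3))
    (I.mul_mem_left _ h4))

theorem tetraForm_pow_mem_of_even (h2 : e2 ∈ I) (h4 : e4 ∈ I) (h6 : e6 ∈ I)
    {y : MvPolynomial (Fin 3) ℝ} (hy : IsTetraForm y) (k : ℕ) : y ^ (k + 8) ∈ I := by
  rw [pow_add, hy.pow_eight]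
  exact I.mul_mem_left _ (I.add_mem (I.mul_mem_left _ (I.add_mem (I.mul_mem_left _ h2)
    (I.mul_mem_left _ h4))) (I.mul_mem_left _ h6))

theorem tetraSum_mem_of_pow_mem {k : ℕ} (h : ∀ y, IsTetraForm y → y ^ k ∈ I) : tetraSum k ∈ I :=
  I.add_mem (I.add_mem (I.add_mem (h _ (.inl rfl)) (h _ (.inr (.inl rfl))))
    (h _ (.inr (.inr (.inl rfl))))) (h _ (.inr (.inr (.inr rfl))))

theorem linForm_vert_pow_mem {k : ℕ} (h : ∀ y, IsTetraForm y → y ^ k ∈ I) (r : ℝ) (i : Fin 8) :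
    linForm (vert r i) ^ k ∈ I := by
  have hA := h _ (.inl rfl)
  have hB := h _ (.inr (.inl rfl))
  have hC := h _ (.inr (.inr (.inl rfl)))
  have hD := h _ (.inr (.inr (.inr rfl)))
  have hsmul : ∀ {v w : Fin 3 → ℝ}, w = (-(r / 3)) • v → linForm v ^ k ∈ I → linForm w ^ k ∈ I := by
    rintro v w rfl hv
    rw [linForm_smul, mul_pow]
    exact I.mul_mem_left _ hv
  fin_cases i
  exacts [hA, hB, hC, hD, hsmul (va_eq r) hA, hsmul (vb_eq r) hB, hsmul (vc_eq r) hC,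
    hsmul (vd_eq r) hD]

theorem tetraSum_mem (h2 : e2 ∈ I) (h3 : e3 ∈ I) (h4 : e4 ∈ I) {k : ℕ} (hk : 1 ≤ k) :
    tetraSum k ∈ I := by
  rcases lt_or_ge k 4 with h | h
  · interval_cases k
    · simp [tetraSum_one]
    · rw [tetraSum_two]; exact I.mul_mem_left _ h2
    · rw [tetraSum_three]; exact I.mul_mem_left _ h3
  · obtain ⟨j, rfl⟩ := Nat.exists_eq_add_of_le' h
    exact tetraSum_mem_of_pow_mem fun y hy => tetraForm_pow_mem h2 h3 h4 hy j

theorem tetraSum_mem_of_even (h2 : e2 ∈ I) (h4 : e4 ∈ I) (h6 : e6 ∈ I) {k : ℕ} (hk : 1 ≤ k)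
    (hev : Even k) : tetraSum k ∈ I := by
  rcases lt_or_ge k 8 with h | h
  · obtain ⟨j, rfl⟩ := hev
    have : j = 1 ∨ j = 2 ∨ j = 3 := by omega
    rcases this with rfl | rfl | rfl
    · rw [tetraSum_two]; exact I.mul_mem_left _ h2
    · rw [tetraSum_four]; exact I.add_mem (I.mul_mem_left _ h2) (I.mul_mem_left _ h4)
    · rw [tetraSum_six]; exact I.add_mem (I.mul_mem_left _ h2) (I.mul_mem_left _ h6)
  · obtain ⟨j, rfl⟩ := Nat.exists_eq_add_of_le' h
    exact tetraSum_mem_of_pow_mem fun y hy => tetraForm_pow_mem_of_even h2 h4 h6 hy j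

theorem tetraSum_mem_of_powSum_mem {r : ℝ} {k : ℕ} (hc : 1 + (-(r / 3)) ^ k ≠ 0)
    (h : powSum r k ∈ I) : tetraSum k ∈ I := by
  rwa [powSum_eq, C_mul_mem_iff hc] at h

theorem generators_mem_of_powSum_mem {r : ℝ} (h : ∀ k, 1 ≤ k → powSum r k ∈ I) :
    e2 ∈ I ∧ e4 ∈ I ∧ e6 ∈ I := by
  have hev : ∀ k, 1 ≤ k → Even k → tetraSum k ∈ I := fun k hk hk2 =>
    tetraSum_mem_of_powSum_mem (by have := hk2.pow_nonneg (-(r / 3)); positivity) (h k hk)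
  have h2 : e2 ∈ I := by
    rw [← C_mul_mem_iff (c := 4) (by norm_num), ← tetraSum_two]
    exact hev 2 (by norm_num) (by decide)
  have h4 : e4 ∈ I := by
    rw [← C_mul_mem_iff (c := 16) (by norm_num), ← I.add_mem_iff_right (I.mul_mem_left _ h2),
      ← tetraSum_four]
    exact hev 4 (by norm_num) (by decide)
  have h6 : e6 ∈ I := by
    rw [← C_mul_mem_iff (c := 192) (by norm_num), ← I.add_mem_iff_right (I.mul_mem_left _ h2),
      ← tetraSum_six]
    exact hev 6 (by norm_num) (by decide)
  exact ⟨h2, h4, h6⟩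

theorem e3_mem_of_powSum_mem {r : ℝ} (hr : r ≠ 3) (h : powSum r 3 ∈ I) : e3 ∈ I := by
  rw [← C_mul_mem_iff (c := 24) (by norm_num), ← tetraSum_three]
  refine tetraSum_mem_of_powSum_mem (fun h0 => hr ?_) h
  have h1 : (r / 3) ^ 3 = 1 ^ 3 := by linear_combination -h0
  have h2 : r / 3 = 1 := (Odd.strictMono_pow (R := ℝ) (n := 3) (by decide)).injective h1
  linarith

end PowerSums

section MeanValue

/-- The mean value property with respect to the vertices of the triakis tetrahedron. -/
def MeanValue (r : ℝ) (f : (Fin 3 → ℝ) → ℝ) : Prop :=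
  ∀ (x : Fin 3 → ℝ) (s : ℝ), 0 < s → ∑ i, f (x + s • vert r i) = 8 * f x

variable {r : ℝ}

theorem diffOp_powSum_apply (g : smoothFun) (k : ℕ) (x : Fin 3 → ℝ) :
    (diffOp (powSum r k) g).1 x = ∑ i, (diffOp (linForm (vert r i) ^ k) g).1 x := by
  simp [powSum, map_sum, LinearMap.sum_apply]

theorem hasDerivAt_vertexSum (r : ℝ) (g : smoothFun) (k : ℕ) (x : Fin 3 → ℝ) (s : ℝ) :
    HasDerivAt (fun t : ℝ => ∑ i, (diffOp (linForm (vert r i) ^ k) g).1 (x + t • vert r i))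
      (∑ i, (diffOp (linForm (vert r i) ^ (k + 1)) g).1 (x + s • vert r i)) s := by
  refine HasDerivAt.fun_sum fun i _ => ?_
  have := hasDerivAt_line (diffOp (linForm (vert r i) ^ k) g) x (vert r i) s
  rwa [← Module.End.mul_apply, ← map_mul, ← pow_succ'] at this

theorem diffOp_powSum_eq_zero {g : smoothFun} (hg : MeanValue r g.1) {k : ℕ} (hk : 1 ≤ k) :
    diffOp (powSum r k) g = 0 := by
  have hconst : ∀ (x : Fin 3 → ℝ) (k : ℕ), ∃ c : ℝ, (1 ≤ k → c = 0) ∧ ∀ s : ℝ, 0 < s →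
      ∑ i, (diffOp (linForm (vert r i) ^ k) g).1 (x + s • vert r i) = c := by
    intro x k
    induction k with
    | zero => exact ⟨8 * g.1 x, by simp, fun s hs => by simpa using hg x s hs⟩
    | succ k ih =>
      obtain ⟨c, -, hc⟩ := ih
      refine ⟨0, fun _ => rfl, fun s hs => ?_⟩
      refine (hasDerivAt_vertexSum r g k x s).unique ?_
      refine (hasDerivAt_const s c).congr_of_eventuallyEq ?_
      filter_upwards [lt_mem_nhds hs] with t ht using hc t ht
  ext x
  rw [diffOp_powSum_apply]
  obtain ⟨c, hc0, hc⟩ := hconst x k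
  have hcont := (hasDerivAt_vertexSum r g k x 0).continuousAt.tendsto
  have h1 := hcont.mono_left (nhdsWithin_le_nhds (s := Set.Ioi 0))
  have h2 := (tendsto_const_nhds (x := c)).congr' <| by
    filter_upwards [self_mem_nhdsWithin (s := Set.Ioi (0 : ℝ)) (a := 0)] with t ht
      using (hc t ht).symm
  have := tendsto_nhds_unique h1 h2
  simpa [hc0 hk] using this

theorem meanValue_of_diffOp_powSum {g : smoothFun}
    (h : ∀ k, 1 ≤ k → diffOp (powSum r k) g = 0) {N : ℕ}
    (hN : ∀ i, diffOp (linForm (vert r i) ^ (N + 1)) g = 0) : MeanValue r g.1 := by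
  have hconst : ∀ k (x : Fin 3 → ℝ),
      (∀ s : ℝ, ∑ i, (diffOp (linForm (vert r i) ^ (k + 1)) g).1 (x + s • vert r i) = 0) →
      ∀ s : ℝ, ∑ i, (diffOp (linForm (vert r i) ^ k) g).1 (x + s • vert r i) =
        ∑ i, (diffOp (linForm (vert r i) ^ k) g).1 x := by
    intro k x hk s
    have := is_const_of_deriv_eq_zero
      (fun t => (hasDerivAt_vertexSum r g k x t).differentiableAt)
      (fun t => (hasDerivAt_vertexSum r g k x t).deriv.trans (hk t)) s 0
    simpa using this
  have hdown : ∀ j k, k + j = N → ∀ (x : Fin 3 → ℝ) (s : ℝ),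
      ∑ i, (diffOp (linForm (vert r i) ^ (k + 1)) g).1 (x + s • vert r i) = 0 := by
    intro j
    induction j with
    | zero =>
      rintro k rfl x s
      exact Finset.sum_eq_zero fun i _ => by rw [Nat.add_zero] at hN; rw [hN]; rfl
    | succ j ih =>
      intro k hk x s
      rw [hconst (k + 1) x (ih (k + 1) (by omega) x) s, ← diffOp_powSum_apply,
        h (k + 1) (by omega)]
      simp
  intro x s _
  simpa using hconst 0 x (hdown N 0 (by omega) x) s

end MeanValue

section Interpolation

/-- The Lagrange basis polynomials for the nodes `0, …, 5`. -/
noncomputable def lagrangeBasis (j : ℕ) : Polynomial ℝ :=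
  Lagrange.basis (Finset.range 6) (fun n : ℕ => (n : ℝ)) j

theorem exists_derivative_eq {n : ℕ} {q : Polynomial ℝ} (hq : q.degree < n) :
    ∃ Q : Polynomial ℝ, Q.degree < (n + 1 : ℕ) ∧ Polynomial.derivative Q = q := by
  refine ⟨∑ i ∈ Finset.range n, Polynomial.C (q.coeff i / (i + 1)) * Polynomial.X ^ (i + 1),
    ?_, ?_⟩
  · rw [← Polynomial.mem_degreeLT]
    refine Submodule.sum_mem _ fun i hi => ?_
    rw [Polynomial.mem_degreeLT]
    refine (Polynomial.degree_C_mul_X_pow_le _ _).trans_lt ?_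
    exact_mod_cast Nat.succ_lt_succ (Finset.mem_range.1 hi)
  · ext j
    have hterm : ∀ i : ℕ, Polynomial.derivative
        (Polynomial.C (q.coeff i / (i + 1)) * Polynomial.X ^ (i + 1)) =
          Polynomial.C (q.coeff i) * Polynomial.X ^ i := fun i => by
      have : (i : ℝ) + 1 ≠ 0 := by positivity
      rw [Polynomial.derivative_C_mul_X_pow]
      simp [div_mul_cancel₀ _ this]
    simp only [Polynomial.derivative_sum, hterm, Polynomial.finsetSum_coeff,
      Polynomial.coeff_C_mul_X_pow, Finset.sum_ite_eq, Finset.mem_range]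
    split_ifs with hj
    · rfl
    · exact (Polynomial.coeff_eq_zero_of_degree_lt
        (hq.trans_le (by exact_mod_cast not_lt.1 hj))).symm

theorem exists_polynomial_of_hasDerivAt (n : ℕ) (φ : ℕ → ℝ → ℝ)
    (h : ∀ k t, HasDerivAt (φ k) (φ (k + 1) t) t) (h0 : ∀ t, φ n t = 0) :
    ∃ q : Polynomial ℝ, q.degree < n ∧ ∀ t, φ 0 t = q.eval t := by
  induction n generalizing φ with
  | zero => exact ⟨0, by simp, by simpa using h0⟩
  | succ n ih =>
    obtain ⟨q, hq, hφ⟩ := ih (fun k => φ (k + 1)) (fun k => h (k + 1)) h0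
    obtain ⟨Q, hQ, rfl⟩ := exists_derivative_eq hq
    have hd : ∀ t, HasDerivAt (fun t => φ 0 t - Q.eval t) 0 t := fun t => by
      simpa [← hφ t] using (h 0 t).fun_sub (Q.hasDerivAt t)
    refine ⟨Q + Polynomial.C (φ 0 0 - Q.eval 0), ?_, fun t => ?_⟩
    · rw [← Polynomial.mem_degreeLT] at *
      refine Submodule.add_mem _ hQ ?_
      rw [Polynomial.mem_degreeLT]
      exact Polynomial.degree_C_le.trans_lt (by exact_mod_cast n.succ_pos)
    · have := is_const_of_deriv_eq_zero (fun t => (hd t).differentiableAt)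
        (fun t => (hd t).deriv) t 0
      rw [Polynomial.eval_add, Polynomial.eval_C]
      linarith

/-- A function with the property that it is recovered by interpolation at the nodes `0, …, 5` in
every variable. -/
def IsInterpolated (f : (Fin 3 → ℝ) → ℝ) : Prop :=
  ∀ (i : Fin 3) (x : Fin 3 → ℝ), f x =
    ∑ j ∈ Finset.range 6, f (Function.update x i j) * (lagrangeBasis j).eval (x i)

theorem isInterpolated_of_diffOp {g : smoothFun} (hg : ∀ i, diffOp (X i ^ 6) g = 0) :
    IsInterpolated g.1 := by
  intro i x
  obtain ⟨q, hq, hq'⟩ := exists_polynomial_of_hasDerivAt 6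
    (fun k t => (diffOp (X i ^ k) g).1 (Function.update x i t))
    (fun k t => by
      have := hasDerivAt_update_apply (diffOp (X i ^ k) g) x i t
      rwa [← Module.End.mul_apply, ← map_mul, ← pow_succ'] at this)
    (fun t => by rw [hg]; rfl)
  simp only [pow_zero, map_one, Module.End.one_apply] at hq'
  have hint := Lagrange.eq_interpolate (s := Finset.range 6) (v := fun n : ℕ => (n : ℝ))
    (Nat.cast_injective.injOn) (f := q) (by simpa using hq)
  have hx : g.1 x = q.eval (x i) := by rw [← hq', Function.update_eq_self]
  rw [hx, hint, Lagrange.interpolate_apply, Polynomial.eval_finsetSum]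
  refine Finset.sum_congr rfl fun j _ => ?_
  rw [Polynomial.eval_mul, Polynomial.eval_C, hq', lagrangeBasis]

theorem IsInterpolated.of_tendsto {F : ℕ → (Fin 3 → ℝ) → ℝ} {f : (Fin 3 → ℝ) → ℝ}
    (hF : ∀ n, IsInterpolated (F n)) (h : ∀ x, Filter.Tendsto (F · x) Filter.atTop (nhds (f x))) :
    IsInterpolated f := by
  intro i x
  refine tendsto_nhds_unique (h x) ?_
  simp only [fun n => hF n i x]
  exact tendsto_finsetSum _ fun j _ => (h _).mul_const _

theorem IsInterpolated.exists_polynomial {f : (Fin 3 → ℝ) → ℝ} (hf : IsInterpolated f) :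
    ∃ p : MvPolynomial (Fin 3) ℝ, ∀ x, f x = eval x p := by
  refine ⟨∑ j ∈ Finset.range 6, ∑ k ∈ Finset.range 6, ∑ l ∈ Finset.range 6,
    C (f ![(j : ℝ), k, l]) * Polynomial.aeval (X 2) (lagrangeBasis l) *
      Polynomial.aeval (X 1) (lagrangeBasis k) * Polynomial.aeval (X 0) (lagrangeBasis j),
    fun x => ?_⟩
  have heval : ∀ (i : Fin 3) (q : Polynomial ℝ),
      eval x (Polynomial.aeval (X i : MvPolynomial (Fin 3) ℝ) q) = q.eval (x i) := by
    intro i q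
    have := Polynomial.hom_eval₂ q (algebraMap ℝ (MvPolynomial (Fin 3) ℝ)) (eval x) (X i)
    rw [Polynomial.aeval_def, this, eval_X]
    congr 1
    ext; simp
  simp only [map_sum, map_mul, eval_C, heval]
  rw [hf 0 x]
  refine Finset.sum_congr rfl fun j _ => ?_
  rw [hf 1 (Function.update x 0 j), Finset.sum_mul]
  refine Finset.sum_congr rfl fun k _ => ?_
  rw [hf 2 (Function.update _ 1 (k : ℝ)), Finset.sum_mul, Finset.sum_mul]
  refine Finset.sum_congr rfl fun l _ => ?_
  have : Function.update (Function.update (Function.update x 0 (j : ℝ)) 1 (k : ℝ)) 2 (l : ℝ) =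
      ![(j : ℝ), k, l] := by
    ext i; fin_cases i <;> simp [Function.update]
  rw [this]
  simp [Function.update]

end Interpolation

section Mollification

open MeasureTheory Filter Topology
open scoped Convolution

/-- The mollification of `f` by a normalized bump function. -/
noncomputable def mollify (φ : ContDiffBump (0 : Fin 3 → ℝ)) (f : (Fin 3 → ℝ) → ℝ) :
    (Fin 3 → ℝ) → ℝ :=
  φ.normed volume ⋆[ContinuousLinearMap.lsmul ℝ ℝ, volume] f

variable {f : (Fin 3 → ℝ) → ℝ}

theorem contDiff_mollify (φ : ContDiffBump (0 : Fin 3 → ℝ)) (hf : Continuous f) :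
    ContDiff ℝ ∞ (mollify φ f) :=
  φ.hasCompactSupport_normed.contDiff_convolution_left _ φ.contDiff_normed hf.locallyIntegrable

theorem MeanValue.mollify {r : ℝ} (φ : ContDiffBump (0 : Fin 3 → ℝ)) (hf : Continuous f)
    (h : MeanValue r f) : MeanValue r (mollify φ f) := by
  intro x s hs
  have hint : ∀ y, Integrable (fun t => φ.normed volume t * f (y - t)) volume := fun y =>
    φ.hasCompactSupport_normed.convolutionExists_left (ContinuousLinearMap.lsmul ℝ ℝ)
      φ.continuous_normed hf.locallyIntegrable y
  have hval : ∀ y, _root_.mollify φ f y = ∫ t, φ.normed volume t * f (y - t) := fun y => rfl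
  simp only [hval]
  rw [← integral_finsetSum _ fun i _ => hint _, ← integral_const_mul]
  refine integral_congr_ae (Eventually.of_forall fun t => ?_)
  simp only [← Finset.mul_sum, add_sub_right_comm, h (x - t) s hs]
  ring

theorem exists_tendsto_mollify (hf : Continuous f) : ∃ φ : ℕ → ContDiffBump (0 : Fin 3 → ℝ),
    ∀ x, Tendsto (fun n => mollify (φ n) f x) atTop (𝓝 (f x)) := by
  refine ⟨fun n => ⟨1 / (n + 1) / 2, 1 / (n + 1), by positivity, half_lt_self (by positivity)⟩,
    fun x => ?_⟩
  exact ContDiffBump.convolution_tendsto_right_of_continuous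
    tendsto_one_div_add_atTop_nhds_zero_nat hf x

end Mollification

theorem MeanValue.exists_polynomial {r : ℝ} {f : (Fin 3 → ℝ) → ℝ} (hf : Continuous f)
    (h : MeanValue r f) : ∃ p : MvPolynomial (Fin 3) ℝ, ∀ x, f x = eval x p := by
  obtain ⟨φ, hφ⟩ := exists_tendsto_mollify hf
  refine (IsInterpolated.of_tendsto (fun n => ?_) hφ).exists_polynomial
  let g : smoothFun := ⟨_, mem_smoothFun.2 (contDiff_mollify (φ n) hf)⟩
  have hg : ∀ k, 1 ≤ k → powSum r k ∈ annIdeal diffOp g := fun k hk =>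
    diffOp_powSum_eq_zero (g := g) (h.mollify (φ n) hf) hk
  obtain ⟨h2, h4, h6⟩ := generators_mem_of_powSum_mem hg
  refine isInterpolated_of_diffOp (g := g) fun i => ?_
  rw [← mem_annIdeal, X_pow_six]
  exact Ideal.add_mem _ (Ideal.sub_mem _ (Ideal.mul_mem_left _ _ h2) (Ideal.mul_mem_left _ _ h4))
    (Ideal.mul_mem_left _ _ h6)

theorem mem_annIdeal_polyFun {φ p : MvPolynomial (Fin 3) ℝ} :
    φ ∈ annIdeal diffOp (polyFun p) ↔ dop φ p = 0 := by
  rw [mem_annIdeal, diffOp_polyFun, polyFun_eq_zero]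

theorem meanValue_iff {r : ℝ} {f : (Fin 3 → ℝ) → ℝ} :
    MeanValue r f ↔ ∀ (x : Fin 3 → ℝ) (s : ℝ), 0 < s →
        f x = (1 / 8) *
          (f (x + s • vA) + f (x + s • vB) + f (x + s • vC) + f (x + s • vD) +
           f (x + s • va r) + f (x + s • vb r) + f (x + s • vc r) + f (x + s • vd r)) := by
  refine forall₃_congr fun x s _ => ?_
  simp only [vert, Fin.sum_univ_eight, Matrix.cons_val]
  constructor <;> intro h <;> linarith

theorem triakisTetrahedron_vertex_harmonics
    (r : ℝ) (hr : 0 < r) (f : (Fin 3 → ℝ) → ℝ) (hf : Continuous f) :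
    (∀ (x : Fin 3 → ℝ) (s : ℝ), 0 < s →
        f x = (1 / 8) *
          (f (x + s • vA) + f (x + s • vB) + f (x + s • vC) + f (x + s • vD) +
           f (x + s • va r) + f (x + s • vb r) + f (x + s • vc r) + f (x + s • vd r))) ↔
      ((r = 3 → ∃ p : MvPolynomial (Fin 3) ℝ,
          dop e2 p = 0 ∧ dop e4 p = 0 ∧ dop e6 p = 0 ∧ ∀ x, f x = eval x p) ∧
       (r ≠ 3 → ∃ p : MvPolynomial (Fin 3) ℝ,
          dop e2 p = 0 ∧ dop e3 p = 0 ∧ dop e4 p = 0 ∧ ∀ x, f x = eval x p)) := by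
  rw [← meanValue_iff]
  constructor
  · intro h
    obtain ⟨p, hp⟩ := h.exists_polynomial hf
    have hpf : (polyFun p).1 = f := by ext x; rw [hp, polyFun_apply]
    have hI : ∀ k, 1 ≤ k → powSum r k ∈ annIdeal diffOp (polyFun p) := fun k hk =>
      diffOp_powSum_eq_zero (hpf ▸ h) hk
    obtain ⟨h2, h4, h6⟩ := generators_mem_of_powSum_mem hI
    refine ⟨fun _ => ⟨p, ?_⟩, fun hr3 => ⟨p, ?_⟩⟩
    · simp only [← mem_annIdeal_polyFun]
      exact ⟨h2, h4, h6, hp⟩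
    · simp only [← mem_annIdeal_polyFun]
      exact ⟨h2, e3_mem_of_powSum_mem hr3 (hI 3 (by norm_num)), h4, hp⟩
  · rintro ⟨heq, hne⟩
    by_cases hr3 : r = 3
    · obtain ⟨p, h2, h4, h6, hp⟩ := heq hr3
      have hpf : (polyFun p).1 = f := by ext x; rw [hp, polyFun_apply]
      rw [← mem_annIdeal_polyFun] at h2 h4 h6
      rw [← hpf]
      refine meanValue_of_diffOp_powSum (fun k hk => ?_) (N := 7) fun i =>
        linForm_vert_pow_mem (fun y hy => tetraForm_pow_mem_of_even h2 h4 h6 hy 0) r i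
      rw [← mem_annIdeal, powSum_eq]
      rcases Nat.even_or_odd k with hk2 | hk2
      · exact Ideal.mul_mem_left _ _ (tetraSum_mem_of_even h2 h4 h6 hk hk2)
      · simp [hr3, hk2.neg_one_pow]
    · obtain ⟨p, h2, h3, h4, hp⟩ := hne hr3
      have hpf : (polyFun p).1 = f := by ext x; rw [hp, polyFun_apply]
      rw [← mem_annIdeal_polyFun] at h2 h3 h4
      rw [← hpf]
      refine meanValue_of_diffOp_powSum (fun k hk => ?_) (N := 3) fun i =>
        linForm_vert_pow_mem (fun y hy => tetraForm_pow_mem h2 h3 h4 hy 0) r i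
      rw [← mem_annIdeal, powSum_eq]
      exact Ideal.mul_mem_left _ _ (tetraSum_mem h2 h3 h4 hk)
end

section
/- Let (τ_m)_{m≥2} be a family of polynomials in ℝ[x₁,x₂,x₃] such that each τ_m is homogeneous of degree m and lies in the ℝ-subalgebra generated by e₂, e₄, e₆. Suppose τ₂ = a₂·e₂, τ₄ = b₄·e₂² (i.e. the coefficient of e₄ in τ₄ vanishes), τ₆ = a₆·e₆ + b₆·e₂·e₄ + c₆·e₂³, and τ₈ = a₈·e₄² + b₈·e₂·e₆ + c₈·e₂²·e₄ + d₈·e₂⁴, where none of a₂, a₆, a₈ is zero. Then for any polynomial f ∈ ℝ[x₁,x₂,x₃], one has τ_m(∂)f = 0 for all m ≥ 2 if and only if e₂(∂)f = e₆(∂)f = e₄(∂)²f = 0. -/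
open MvPolynomial

theorem commute_pderiv {R σ : Type*} [CommRing R] (i j : σ) :
    Commute (pderiv (R := R) i).toLinearMap (pderiv (R := R) j).toLinearMap := by
  classical
  have h : ⁅pderiv (R := R) i, pderiv (R := R) j⁆ = 0 := by
    ext k
    simp [Derivation.commutator_apply, pderiv_X, Pi.single_apply, apply_ite]
  refine LinearMap.ext fun p => sub_eq_zero.mp ?_
  simpa [Derivation.commutator_apply] using DFunLike.congr_fun h p

/-- The monomial differential operators `∂ˢ`, multiplicative in the exponent `s`. -/
noncomputable def monomialOp :
    Multiplicative (Fin 3 →₀ ℕ) →* Module.End ℝ (MvPolynomial (Fin 3) ℝ) where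
  toFun s := (pderiv (0 : Fin 3)).toLinearMap ^ s.toAdd 0 *
    (pderiv (1 : Fin 3)).toLinearMap ^ s.toAdd 1 * (pderiv (2 : Fin 3)).toLinearMap ^ s.toAdd 2
  map_one' := by simp
  map_mul' s t := by
    simp only [toAdd_mul, Finsupp.add_apply, pow_add]
    rw [(((commute_pderiv (R := ℝ) (2 : Fin 3) 0).pow_pow _ _).mul_right
      ((commute_pderiv 2 1).pow_pow _ _)).mul_mul_mul_comm,
      ((commute_pderiv (R := ℝ) (1 : Fin 3) 0).pow_pow _ _).mul_mul_mul_comm]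

/-- The map `φ ↦ φ(∂)` as an algebra homomorphism. -/
noncomputable def dopHom :
    MvPolynomial (Fin 3) ℝ →ₐ[ℝ] Module.End ℝ (MvPolynomial (Fin 3) ℝ) :=
  AddMonoidAlgebra.lift ℝ _ _ monomialOp

theorem dopHom_apply (φ : MvPolynomial (Fin 3) ℝ) : dopHom φ = dop φ :=
  AddMonoidAlgebra.lift_apply monomialOp φ

theorem dop_mul_apply (φ ψ f : MvPolynomial (Fin 3) ℝ) :
    dop (φ * ψ) f = dop φ (dop ψ f) := by
  simp [← dopHom_apply]

/-- The ideal of polynomials `φ` with `φ(∂) f = 0`. -/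
noncomputable def dopAnnihilator (f : MvPolynomial (Fin 3) ℝ) :
    Ideal (MvPolynomial (Fin 3) ℝ) where
  carrier := {φ | dop φ f = 0}
  zero_mem' := by simp [← dopHom_apply]
  add_mem' {φ ψ} hφ hψ := by
    simp only [Set.mem_ofPred_eq, ← dopHom_apply] at hφ hψ ⊢
    simp [hφ, hψ]
  smul_mem' φ ψ hψ := by
    simp only [Set.mem_ofPred_eq, smul_eq_mul, dop_mul_apply] at hψ ⊢
    simp [hψ]

theorem mem_dopAnnihilator {φ f : MvPolynomial (Fin 3) ℝ} :
    φ ∈ dopAnnihilator f ↔ dop φ f = 0 := Iff.rfl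

theorem e2_isHomogeneous : e2.IsHomogeneous 2 :=
  ((isHomogeneous_X_pow _ _).add (isHomogeneous_X_pow _ _)).add (isHomogeneous_X_pow _ _)

theorem e4_isHomogeneous : e4.IsHomogeneous 4 := by
  have h (i j : Fin 3) : (X i ^ 2 * X j ^ 2 : MvPolynomial (Fin 3) ℝ).IsHomogeneous 4 :=
    (isHomogeneous_X_pow i 2).mul (isHomogeneous_X_pow j 2)
  exact ((h _ _).add (h _ _)).add (h _ _)

theorem e6_isHomogeneous : e6.IsHomogeneous 6 :=
  ((isHomogeneous_X_pow _ 2).mul (isHomogeneous_X_pow _ 2)).mul (isHomogeneous_X_pow _ 2)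

/-- The ideal generated by `e₂`, `e₆` and `e₄²`. -/
noncomputable def solIdeal : Ideal (MvPolynomial (Fin 3) ℝ) :=
  Ideal.span {e2, e6, e4 ^ 2}

theorem e2_mem_solIdeal : e2 ∈ solIdeal := Ideal.subset_span (by simp)

theorem e6_mem_solIdeal : e6 ∈ solIdeal := Ideal.subset_span (by simp)

theorem e4_sq_mem_solIdeal : e4 ^ 2 ∈ solIdeal := Ideal.subset_span (by simp)

theorem homogeneousComponent_mem_solIdeal {φ : MvPolynomial (Fin 3) ℝ} (hφ : φ ∈ solIdeal)
    (m : ℕ) : homogeneousComponent m φ ∈ solIdeal := by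
  let := gradedAlgebra (σ := Fin 3) (R := ℝ)
  have h : solIdeal.IsHomogeneous (homogeneousSubmodule (Fin 3) ℝ) := by
    refine Ideal.homogeneous_span _ _ ?_
    rintro x (rfl | rfl | rfl)
    · exact ⟨2, e2_isHomogeneous⟩
    · exact ⟨6, e6_isHomogeneous⟩
    · exact ⟨8, e4_isHomogeneous.pow 2⟩
  rw [← decomposition.decompose'_apply]
  exact h m hφ

theorem exists_sub_mem_solIdeal {φ : MvPolynomial (Fin 3) ℝ}
    (hφ : φ ∈ Algebra.adjoin ℝ ({e2, e4, e6} : Set (MvPolynomial (Fin 3) ℝ))) :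
    ∃ c d : ℝ, φ - (C c + C d * e4) ∈ solIdeal := by
  induction hφ using Algebra.adjoin_induction with
  | mem x hx =>
    rcases hx with rfl | rfl | rfl
    · exact ⟨0, 0, by simpa using e2_mem_solIdeal⟩
    · exact ⟨0, 1, by simp⟩
    · exact ⟨0, 0, by simpa using e6_mem_solIdeal⟩
  | algebraMap r => exact ⟨r, 0, by simp [algebraMap_eq]⟩
  | add x y _ _ hx hy =>
    obtain ⟨a, b, hx⟩ := hx
    obtain ⟨c, d, hy⟩ := hy
    refine ⟨a + c, b + d, ?_⟩
    convert add_mem hx hy using 1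
    simp only [map_add]
    ring
  | mul x y _ _ hx hy =>
    obtain ⟨a, b, hx⟩ := hx
    obtain ⟨c, d, hy⟩ := hy
    refine ⟨a * c, a * d + b * c, ?_⟩
    convert add_mem (add_mem (solIdeal.mul_mem_left y hx)
      (solIdeal.mul_mem_left (C a + C b * e4) hy))
      (solIdeal.mul_mem_left (C b * C d) e4_sq_mem_solIdeal) using 1
    simp only [map_add, map_mul]
    ring

theorem mem_solIdeal_of_isHomogeneous {φ : MvPolynomial (Fin 3) ℝ} {m : ℕ}
    (hφ : φ ∈ Algebra.adjoin ℝ ({e2, e4, e6} : Set (MvPolynomial (Fin 3) ℝ)))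
    (hm : φ.IsHomogeneous m) (h0 : m ≠ 0) (h4 : m ≠ 4) : φ ∈ solIdeal := by
  obtain ⟨c, d, h⟩ := exists_sub_mem_solIdeal hφ
  have h := homogeneousComponent_mem_solIdeal h m
  rwa [map_sub, map_add, homogeneousComponent_C_mul,
    homogeneousComponent_of_mem hm, homogeneousComponent_of_mem (isHomogeneous_C _ c),
    homogeneousComponent_of_mem e4_isHomogeneous, if_pos rfl, if_neg h0, if_neg h4,
    mul_zero, add_zero, sub_zero] at h

theorem mem_of_C_mul_mem {σ : Type*} {I : Ideal (MvPolynomial σ ℝ)} {a : ℝ} (ha : a ≠ 0)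
    {φ : MvPolynomial σ ℝ} (h : C a * φ ∈ I) : φ ∈ I :=
  (Ideal.unit_mul_mem_iff_mem I (ha.isUnit.map C)).mp h

theorem reduction_to_Sol_harmonics
    (τ : ℕ → MvPolynomial (Fin 3) ℝ)
    (hhom : ∀ m, 2 ≤ m → (τ m).IsHomogeneous m)
    (hadj : ∀ m, 2 ≤ m →
      τ m ∈ Algebra.adjoin ℝ ({e2, e4, e6} : Set (MvPolynomial (Fin 3) ℝ)))
    (a₂ b₄ a₆ b₆ c₆ a₈ b₈ c₈ d₈ : ℝ) (ha₂ : a₂ ≠ 0) (ha₆ : a₆ ≠ 0) (ha₈ : a₈ ≠ 0)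
    (hτ₂ : τ 2 = C a₂ * e2)
    (hτ₄ : τ 4 = C b₄ * e2 ^ 2)
    (hτ₆ : τ 6 = C a₆ * e6 + C b₆ * e2 * e4 + C c₆ * e2 ^ 3)
    (hτ₈ : τ 8 = C a₈ * e4 ^ 2 + C b₈ * e2 * e6 + C c₈ * e2 ^ 2 * e4 + C d₈ * e2 ^ 4)
    (f : MvPolynomial (Fin 3) ℝ) :
    (∀ m, 2 ≤ m → dop (τ m) f = 0) ↔
      (dop e2 f = 0 ∧ dop e6 f = 0 ∧ dop e4 (dop e4 f) = 0) := by
  have hkey : (dop e2 f = 0 ∧ dop e6 f = 0 ∧ dop e4 (dop e4 f) = 0) ↔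
      solIdeal ≤ dopAnnihilator f := by
    rw [solIdeal, Ideal.span_le, ← dop_mul_apply, ← sq]
    simp [Set.insert_subset_iff, mem_dopAnnihilator]
  constructor
  · intro h
    have h2 : e2 ∈ dopAnnihilator f := mem_of_C_mul_mem ha₂ (hτ₂ ▸ h 2 le_rfl)
    have h6 : e6 ∈ dopAnnihilator f := by
      refine mem_of_C_mul_mem ha₆ ?_
      have h6' : τ 6 ∈ dopAnnihilator f := h 6 (by norm_num)
      convert sub_mem h6'
        (Ideal.mul_mem_left _ (C b₆ * e4 + C c₆ * e2 ^ 2) h2) using 1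
      rw [hτ₆]
      ring
    have h8 : e4 ^ 2 ∈ dopAnnihilator f := by
      refine mem_of_C_mul_mem ha₈ ?_
      have h8' : τ 8 ∈ dopAnnihilator f := h 8 (by norm_num)
      convert sub_mem h8'
        (Ideal.mul_mem_left _ (C b₈ * e6 + C c₈ * e2 * e4 + C d₈ * e2 ^ 3) h2) using 1
      rw [hτ₈]
      ring
    refine ⟨h2, h6, ?_⟩
    rwa [← dop_mul_apply, ← sq]
  · intro h m hm
    refine hkey.mp h ?_
    by_cases h4 : m = 4
    · rw [h4, hτ₄, sq, ← mul_assoc]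
      exact Ideal.mul_mem_left _ _ e2_mem_solIdeal
    · exact mem_solIdeal_of_isHomogeneous (hadj m hm) (hhom m hm) (by omega) h4
end

section
/- Let Δ(x) = x₁x₂x₃(x₁²-x₂²)(x₂²-x₃²)(x₃²-x₁²) and F(x) = Δ(x)·(5(x₁⁴+x₂⁴+x₃⁴) - 13(x₁²x₂²+x₂²x₃²+x₃²x₁²)). Then e₂(∂)F = 0, e₆(∂)F = 0, and e₄(∂)F = -15120·Δ. -/
open MvPolynomial

/-- The fundamental alternating polynomial of the Weyl group `W(B₃)`. -/
noncomputable def Δ : MvPolynomial (Fin 3) ℝ :=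
  X 0 * X 1 * X 2 * (X 0 ^ 2 - X 1 ^ 2) * (X 1 ^ 2 - X 2 ^ 2) * (X 2 ^ 2 - X 0 ^ 2)

/-- The degree-13 generator of the solution space `Sol`. -/
noncomputable def F : MvPolynomial (Fin 3) ℝ :=
  Δ * (C 5 * (X 0 ^ 4 + X 1 ^ 4 + X 2 ^ 4) -
       C 13 * (X 0 ^ 2 * X 1 ^ 2 + X 1 ^ 2 * X 2 ^ 2 + X 2 ^ 2 * X 0 ^ 2))

theorem dop_add (φ ψ : MvPolynomial (Fin 3) ℝ) : dop (φ + ψ) = dop φ + dop ψ := by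
  classical
  have h (p : MvPolynomial (Fin 3) ℝ) (hp : p.support ⊆ φ.support ∪ ψ.support) :=
    Finset.sum_subset hp (f := fun s => p.coeff s •
      ((pderiv (R := ℝ) (0 : Fin 3)).toLinearMap ^ s 0 * (pderiv (1 : Fin 3)).toLinearMap ^ s 1 *
        (pderiv (2 : Fin 3)).toLinearMap ^ s 2))
      fun s _ hs => by rw [notMem_support_iff.mp hs, zero_smul]
  rw [dop, dop, dop, h _ support_add, h φ Finset.subset_union_left,
    h ψ Finset.subset_union_right, ← Finset.sum_add_distrib]
  simp only [coeff_add, add_smul]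

theorem dop_monomial (s : Fin 3 →₀ ℕ) :
    dop (monomial s 1) =
      (pderiv (0 : Fin 3)).toLinearMap ^ s 0 * (pderiv (1 : Fin 3)).toLinearMap ^ s 1 *
        (pderiv (2 : Fin 3)).toLinearMap ^ s 2 := by
  classical
  rw [dop, support_monomial, if_neg one_ne_zero, Finset.sum_singleton, coeff_monomial, if_pos rfl,
    one_smul]

/-- The monomial `x₁ᵃ x₂ᵇ x₃ᶜ`. -/
noncomputable def xyzMonomial (a b c : ℕ) : MvPolynomial (Fin 3) ℝ := X 0 ^ a * X 1 ^ b * X 2 ^ c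

theorem dop_xyzMonomial (a b c : ℕ) :
    dop (xyzMonomial a b c) =
      (pderiv (0 : Fin 3)).toLinearMap ^ a * (pderiv (1 : Fin 3)).toLinearMap ^ b *
        (pderiv (2 : Fin 3)).toLinearMap ^ c := by
  have h : xyzMonomial a b c =
      monomial (Finsupp.single 0 a + Finsupp.single 1 b + Finsupp.single 2 c) 1 := by
    simp [xyzMonomial, X_pow_eq_monomial, monomial_mul]
  rw [h, dop_monomial]
  simp

theorem pderiv_zero_xyzMonomial (a b c : ℕ) :
    pderiv 0 (xyzMonomial a b c) = (a : ℝ) • xyzMonomial (a - 1) b c := by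
  simp [xyzMonomial, smul_eq_C_mul]
  ring

theorem pderiv_one_xyzMonomial (a b c : ℕ) :
    pderiv 1 (xyzMonomial a b c) = (b : ℝ) • xyzMonomial a (b - 1) c := by
  simp [xyzMonomial, smul_eq_C_mul]
  ring

theorem pderiv_two_xyzMonomial (a b c : ℕ) :
    pderiv 2 (xyzMonomial a b c) = (c : ℝ) • xyzMonomial a b (c - 1) := by
  simp [xyzMonomial, smul_eq_C_mul]
  ring

/-- The alternating sum of the monomials in the orbit of `x₁ᵃ x₂ᵇ x₃ᶜ`. -/
noncomputable def altMonomial (a b c : ℕ) : MvPolynomial (Fin 3) ℝ :=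
  xyzMonomial a b c - xyzMonomial a c b + xyzMonomial b c a - xyzMonomial b a c +
    xyzMonomial c a b - xyzMonomial c b a

theorem F_eq_altMonomial :
    F = (-5 : ℝ) • altMonomial 9 3 1 + (18 : ℝ) • altMonomial 7 5 1 := by
  simp only [F, Δ, altMonomial, xyzMonomial, smul_eq_C_mul, map_neg, map_ofNat]
  ring

theorem Δ_eq_altMonomial : Δ = -altMonomial 5 3 1 := by
  simp only [Δ, altMonomial, xyzMonomial]
  ring

theorem e2_eq_xyzMonomial : e2 = xyzMonomial 2 0 0 + xyzMonomial 0 2 0 + xyzMonomial 0 0 2 := by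
  simp [e2, xyzMonomial]

theorem e4_eq_xyzMonomial : e4 = xyzMonomial 0 2 2 + xyzMonomial 2 0 2 + xyzMonomial 2 2 0 := by
  simp only [e4, xyzMonomial]
  ring

theorem e6_eq_xyzMonomial : e6 = xyzMonomial 2 2 2 := rfl

theorem generator_F_computations :
    dop e2 F = 0 ∧ dop e6 F = 0 ∧ dop e4 F = C (-15120) * Δ := by
  rw [← smul_eq_C_mul, e2_eq_xyzMonomial, e4_eq_xyzMonomial, e6_eq_xyzMonomial, F_eq_altMonomial,
    Δ_eq_altMonomial]
  simp only [dop_add, dop_xyzMonomial, altMonomial, LinearMap.add_apply, Module.End.mul_apply,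
    pow_zero, pow_two, Module.End.one_apply, Derivation.coeFn_coe, map_add, map_sub, map_smul,
    pderiv_zero_xyzMonomial, pderiv_one_xyzMonomial, pderiv_two_xyzMonomial]
  norm_num
  constructor <;> module
end

section
/- The sextic polynomial χ₁(r) = r⁶ + 2r⁵ + r⁴ - 36r³ - 45r² - 270r - 405 has exactly one positive real root, and this root lies in the open interval (3.623, 3.624). -/
/-- The sextic polynomial arising in the edge problem for isohedral triakis
tetrahedra. -/
noncomputable def χ₁ (r : ℝ) : ℝ :=
  r ^ 6 + 2 * r ^ 5 + r ^ 4 - 36 * r ^ 3 - 45 * r ^ 2 - 270 * r - 405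

/-- The function `r ↦ χ₁ r / r ^ 3` is strictly increasing on the positive reals
(stated without denominators). -/
theorem pow_three_mul_χ₁_lt {a b : ℝ} (ha : 0 < a) (hab : a < b) :
    b ^ 3 * χ₁ a < a ^ 3 * χ₁ b := by
  have hb : 0 < b := ha.trans hab
  have key : a ^ 3 * χ₁ b - b ^ 3 * χ₁ a =
      (b - a) * (a ^ 3 * b ^ 3 * (b ^ 2 + a * b + a ^ 2 + 2 * (a + b) + 1) +
        45 * a ^ 2 * b ^ 2 + 270 * a * b * (a + b) + 405 * (b ^ 2 + a * b + a ^ 2)) := by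
    unfold χ₁
    ring
  rw [← sub_pos, key]
  exact mul_pos (sub_pos.2 hab) (by positivity)

theorem continuous_χ₁ : Continuous χ₁ := by
  unfold χ₁
  fun_prop

theorem sextic_unique_positive_root :
    ∃ x : ℝ, (0 < x ∧ χ₁ x = 0) ∧ (∀ y : ℝ, 0 < y → χ₁ y = 0 → y = x) ∧
      3.623 < x ∧ x < 3.624 := by
  have hl : χ₁ 3.623 < 0 := by norm_num [χ₁]
  have hr : 0 < χ₁ 3.624 := by norm_num [χ₁]
  obtain ⟨x, ⟨hx₁, hx₂⟩, hx⟩ :=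
    intermediate_value_Ioo (by norm_num : (3.623 : ℝ) ≤ 3.624) continuous_χ₁.continuousOn
      ⟨hl, hr⟩
  have hpos : 0 < x := by linarith
  refine ⟨x, ⟨hpos, hx⟩, fun y hy hy₀ => ?_, hx₁, hx₂⟩
  rcases lt_trichotomy y x with h | h | h
  · simpa [hx, hy₀] using pow_three_mul_χ₁_lt hy h
  · exact h
  · simpa [hx, hy₀] using pow_three_mul_χ₁_lt hpos h
end
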